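/- arXiv:2209.14090 — 8 statements merged into one kernel-verified Lean document; each statement's English description precedes it below -/
import Mathlib

section
/- Let G be an abelian group, R a commutative ring graded by G, and q a prime ideal of the degree-zero subring R₀. Then q̃ := ⊕_{g∈G} {r ∈ R_g | r·R_{−g} ⊆ q} is a G-prime ideal of R (in particular it is a proper homogeneous ideal), and its degree-zero part satisfies q̃ ∩ R₀ = q. -/
/-!
STATEMENT 1: Let `G` be an abelian group, `R` a commutative ring graded by `G`,
and `q` a prime ideal of the degree-zero subring `R₀`. Then
`q̃ := ⊕_{g∈G} {r ∈ R_g | r·R_{−g} ⊆ q}` is a `G`-prime ideal of `R`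
(in particular a proper homogeneous ideal), and `q̃ ∩ R₀ = q`.
-/

/-- A homogeneous ideal `p ⊊ R` is `G`-prime if for all homogeneous `x, y ∈ R`
with `x * y ∈ p`, either `x ∈ p` or `y ∈ p`. -/
def Ideal.IsGPrime {G : Type*} [AddCommGroup G] [DecidableEq G]
    {R : Type*} [CommRing R] (𝒜 : G → AddSubgroup R) [GradedRing 𝒜]
    (p : Ideal R) : Prop :=
  Ideal.IsHomogeneous 𝒜 p ∧ p ≠ ⊤ ∧
    ∀ ⦃x y : R⦄, SetLike.IsHomogeneousElem 𝒜 x → SetLike.IsHomogeneousElem 𝒜 y →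
      x * y ∈ p → x ∈ p ∨ y ∈ p

/-- The degree-zero part `I ∩ R₀` of an ideal `I` of `R`, as an ideal of the
degree-zero subring `R₀`. -/
def Ideal.degZeroPart {G : Type*} [AddCommGroup G] [DecidableEq G]
    {R : Type*} [CommRing R] (𝒜 : G → AddSubgroup R) [GradedRing 𝒜]
    (I : Ideal R) : Ideal ↥(SetLike.GradeZero.subring 𝒜) :=
  I.comap (SetLike.GradeZero.subring 𝒜).subtype

/-- The set `q̃ := ⊕_{g∈G} {r ∈ R_g | r·R_{−g} ⊆ q}`: an element `r` belongs to it
iff every homogeneous component `r_g` of `r` satisfies `r_g · R_{−g} ⊆ q`. -/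
def Ideal.tildeSet {G : Type*} [AddCommGroup G] [DecidableEq G]
    {R : Type*} [CommRing R] (𝒜 : G → AddSubgroup R) [GradedRing 𝒜]
    (q : Ideal ↥(SetLike.GradeZero.subring 𝒜)) : Set R :=
  { r : R | ∀ g : G, ∀ s ∈ 𝒜 (-g),
      ((DirectSum.decompose 𝒜 r g : R) * s) ∈
        (Subtype.val '' (q : Set ↥(SetLike.GradeZero.subring 𝒜))) }

namespace Ideal

variable {G : Type*} [AddCommGroup G] [DecidableEq G]
  {R : Type*} [CommRing R] (𝒜 : G → AddSubgroup R) [GradedRing 𝒜]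
  (q : Ideal ↥(SetLike.GradeZero.subring 𝒜))

/-- On homogeneous elements, membership in `q̃` only involves the one nonzero component. -/
theorem mem_tildeSet_of_mem {x : R} {g : G} (hx : x ∈ 𝒜 g) :
    x ∈ tildeSet 𝒜 q ↔
      ∀ s ∈ 𝒜 (-g), x * s ∈ (Subtype.val '' (q : Set ↥(SetLike.GradeZero.subring 𝒜))) := by
  constructor
  · intro h s hs
    simpa only [DirectSum.decompose_of_mem_same 𝒜 hx] using h g s hs
  · intro h k s hs
    obtain rfl | hk := eq_or_ne g k
    · simpa only [DirectSum.decompose_of_mem_same 𝒜 hx] using h s hs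
    · rw [DirectSum.decompose_of_mem_ne 𝒜 hx hk, zero_mul]
      exact ⟨0, q.zero_mem, rfl⟩

theorem add_mem_tildeSet {x y : R} (hx : x ∈ tildeSet 𝒜 q) (hy : y ∈ tildeSet 𝒜 q) :
    x + y ∈ tildeSet 𝒜 q := by
  intro g s hs
  obtain ⟨a, ha, hax⟩ := hx g s hs
  obtain ⟨b, hb, hby⟩ := hy g s hs
  refine ⟨a + b, q.add_mem ha hb, ?_⟩
  rw [DirectSum.decompose_add, DirectSum.add_apply, Subring.coe_add, hax, hby]
  exact (add_mul _ _ s).symm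

theorem zero_mem_tildeSet : (0 : R) ∈ tildeSet 𝒜 q := by
  intro g s _
  exact ⟨0, q.zero_mem, by simp⟩

theorem mul_mem_tildeSet (a : R) {x : R} (hx : x ∈ tildeSet 𝒜 q) :
    a * x ∈ tildeSet 𝒜 q := by
  induction a using DirectSum.Decomposition.inductionOn 𝒜 with
  | zero => simpa using zero_mem_tildeSet 𝒜 q
  | add a b ha hb => simpa only [add_mul] using add_mem_tildeSet 𝒜 q ha hb
  | @homogeneous h a =>
    intro g s hs
    obtain ⟨k, rfl⟩ : ∃ k, g = h + k := ⟨g - h, by abel⟩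
    rw [DirectSum.coe_decompose_mul_add_of_left_mem 𝒜 a.2, mul_right_comm, mul_comm]
    refine hx k _ ?_
    simpa using SetLike.mul_mem_graded a.2 hs

/-- The homogeneous ideal `q̃` of `R` attached to an ideal `q` of `R₀`. -/
def tilde : Ideal R where
  carrier := tildeSet 𝒜 q
  add_mem' := add_mem_tildeSet 𝒜 q
  zero_mem' := zero_mem_tildeSet 𝒜 q
  smul_mem' a _ hx := mul_mem_tildeSet 𝒜 q a hx

theorem mem_tilde_of_mem {x : R} {g : G} (hx : x ∈ 𝒜 g) :
    x ∈ tilde 𝒜 q ↔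
      ∀ s ∈ 𝒜 (-g), x * s ∈ (Subtype.val '' (q : Set ↥(SetLike.GradeZero.subring 𝒜))) :=
  mem_tildeSet_of_mem 𝒜 q hx

theorem isHomogeneous_tilde : (tilde 𝒜 q).IsHomogeneous 𝒜 := by
  intro g x hx
  exact (mem_tilde_of_mem 𝒜 q (DirectSum.decompose 𝒜 x g).2).2 (hx g)

theorem degZeroPart_tilde : (tilde 𝒜 q).degZeroPart 𝒜 = q := by
  ext x
  change (x : R) ∈ tilde 𝒜 q ↔ x ∈ q
  rw [mem_tilde_of_mem 𝒜 q (g := 0) x.2]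
  constructor
  · intro h
    obtain ⟨y, hy, hyx⟩ := h 1 (by simpa using SetLike.GradedOne.one_mem (A := 𝒜))
    rw [mul_one] at hyx
    exact Subtype.ext hyx ▸ hy
  · intro hx s hs
    rw [neg_zero] at hs
    exact ⟨x * ⟨s, hs⟩, q.mul_mem_right _ hx, rfl⟩

theorem isGPrime_tilde (hq : q.IsPrime) : (tilde 𝒜 q).IsGPrime 𝒜 := by
  refine ⟨isHomogeneous_tilde 𝒜 q, ?_, ?_⟩
  · intro h
    apply hq.ne_top
    rw [← degZeroPart_tilde 𝒜 q, h]
    exact comap_top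
  · rintro x y ⟨g, hx⟩ ⟨h, hy⟩ hxy
    rw [mem_tilde_of_mem 𝒜 q (SetLike.mul_mem_graded hx hy)] at hxy
    rw [mem_tilde_of_mem 𝒜 q hx, mem_tilde_of_mem 𝒜 q hy]
    by_contra! hcon
    obtain ⟨⟨s, hs, hxs⟩, t, ht, hyt⟩ := hcon
    have hxs₀ : x * s ∈ 𝒜 0 := by simpa using SetLike.mul_mem_graded hx hs
    have hyt₀ : y * t ∈ 𝒜 0 := by simpa using SetLike.mul_mem_graded hy ht
    have hst : s * t ∈ 𝒜 (-(g + h)) := by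
      rw [neg_add]
      exact SetLike.mul_mem_graded hs ht
    obtain ⟨z, hz, hzeq⟩ := hxy _ hst
    have hprod : z = (⟨x * s, hxs₀⟩ * ⟨y * t, hyt₀⟩ : ↥(SetLike.GradeZero.subring 𝒜)) :=
      Subtype.ext (hzeq.trans (mul_mul_mul_comm x y s t))
    rw [hprod] at hz
    rcases hq.mem_or_mem hz with hmem | hmem
    · exact hxs ⟨_, hmem, rfl⟩
    · exact hyt ⟨_, hmem, rfl⟩

end Ideal

theorem tilde_isGPrime_and_degZeroPart_eq
    {G : Type*} [AddCommGroup G] [DecidableEq G]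
    {R : Type*} [CommRing R] (𝒜 : G → AddSubgroup R) [GradedRing 𝒜]
    (q : Ideal ↥(SetLike.GradeZero.subring 𝒜)) (hq : q.IsPrime) :
    ∃ I : Ideal R, (I : Set R) = Ideal.tildeSet 𝒜 q ∧
      I.IsGPrime 𝒜 ∧ I.degZeroPart 𝒜 = q :=
  ⟨Ideal.tilde 𝒜 q, rfl, Ideal.isGPrime_tilde 𝒜 q hq, Ideal.degZeroPart_tilde 𝒜 q⟩
end

section
/- Let G be an abelian group and R a commutative ring graded by G. If m is a G-maximal ideal of R, then m ∩ R₀ is a maximal ideal of the ring R₀. -/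
/-- A `G`-maximal ideal of `R` is an ideal maximal among proper homogeneous ideals. -/
def Ideal.IsGMaximal {G : Type*} [AddCommGroup G] [DecidableEq G]
    {R : Type*} [CommRing R] (𝒜 : G → AddSubgroup R) [GradedRing 𝒜]
    (m : Ideal R) : Prop :=
  Ideal.IsHomogeneous 𝒜 m ∧ m ≠ ⊤ ∧
    ∀ J : Ideal R, Ideal.IsHomogeneous 𝒜 J → J ≠ ⊤ → m ≤ J → m = J

/-!
STATEMENT 2: If `m` is a `G`-maximal ideal of `R`, then `m ∩ R₀` is a maximal
ideal of the ring `R₀`.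
-/

theorem Ideal.IsGMaximal.sup_span_singleton_eq_top
    {G : Type*} [AddCommGroup G] [DecidableEq G]
    {R : Type*} [CommRing R] {𝒜 : G → AddSubgroup R} [GradedRing 𝒜]
    {m : Ideal R} (hm : m.IsGMaximal 𝒜) {x : R}
    (hx : SetLike.IsHomogeneousElem 𝒜 x) (hxm : x ∉ m) :
    m ⊔ Ideal.span {x} = ⊤ := by
  obtain ⟨hhom, -, hmax⟩ := hm
  by_contra hne
  have hspan : (Ideal.span {x}).IsHomogeneous 𝒜 :=
    Ideal.homogeneous_span 𝒜 {x} (by rintro y rfl; exact hx)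
  apply hxm
  rw [hmax _ (hhom.sup hspan) hne le_sup_left]
  exact Ideal.mem_sup_right (Ideal.mem_span_singleton_self x)

/-- A degree-zero element outside a `G`-maximal ideal `m` is invertible modulo `m ∩ R₀`. -/
theorem Ideal.IsGMaximal.exists_one_sub_mul_mem_degZeroPart
    {G : Type*} [AddCommGroup G] [DecidableEq G]
    {R : Type*} [CommRing R] {𝒜 : G → AddSubgroup R} [GradedRing 𝒜]
    {m : Ideal R} (hm : m.IsGMaximal 𝒜) {x : SetLike.GradeZero.subring 𝒜}
    (hx : x ∉ m.degZeroPart 𝒜) :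
    ∃ y : SetLike.GradeZero.subring 𝒜, 1 - y * x ∈ m.degZeroPart 𝒜 := by
  have htop := hm.sup_span_singleton_eq_top ⟨0, x.2⟩ hx
  obtain ⟨a, ha, b, hb, hab⟩ := Submodule.mem_sup.mp ((Ideal.eq_top_iff_one _).mp htop)
  obtain ⟨r, rfl⟩ := Ideal.mem_span_singleton'.mp hb
  refine ⟨⟨DirectSum.decompose 𝒜 r 0, (DirectSum.decompose 𝒜 r 0).2⟩, ?_⟩
  change (1 : R) - (DirectSum.decompose 𝒜 r 0 : R) * (x : R) ∈ m
  have hzero : (DirectSum.decompose 𝒜 a 0 : R) =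
      1 - (DirectSum.decompose 𝒜 r 0 : R) * (x : R) := by
    rw [← DirectSum.coe_decompose_mul_of_right_mem_zero 𝒜 x.2, eq_sub_of_add_eq hab,
      DirectSum.decompose_sub, DirectSum.sub_apply, AddSubgroup.coe_sub,
      DirectSum.decompose_of_mem_same 𝒜 SetLike.GradedOne.one_mem]
  exact hzero ▸ hm.1 0 ha

theorem degZeroPart_isMaximal_of_isGMaximal
    {G : Type*} [AddCommGroup G] [DecidableEq G]
    {R : Type*} [CommRing R] (𝒜 : G → AddSubgroup R) [GradedRing 𝒜]
    (m : Ideal R) (hm : m.IsGMaximal 𝒜) :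
    (m.degZeroPart 𝒜).IsMaximal := by
  refine Ideal.isMaximal_iff.mpr
    ⟨fun h => hm.2.1 ((Ideal.eq_top_iff_one m).mpr h), fun J x hJ hx hxJ => ?_⟩
  obtain ⟨y, hy⟩ := hm.exists_one_sub_mul_mem_degZeroPart hx
  simpa using J.add_mem (hJ hy) (J.mul_mem_left y hxJ)
end

section
/- Let G be an abelian group, R a commutative ring graded by G, and q a maximal ideal of the degree-zero subring R₀. Then q̃ := ⊕_{g∈G} {r ∈ R_g | r·R_{−g} ⊆ q} is a G-maximal ideal of R, i.e., it is a proper homogeneous ideal of R that is maximal among proper homogeneous ideals. -/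
/-- The ideal of all `r` such that the degree-zero component of every multiple of `r` lies in
`q`. Its underlying set is `Ideal.tildeSet 𝒜 q`. -/
def Ideal.tilde_s3 {G : Type*} [AddCommGroup G] [DecidableEq G]
    {R : Type*} [CommRing R] (𝒜 : G → AddSubgroup R) [GradedRing 𝒜]
    (q : Ideal ↥(SetLike.GradeZero.subring 𝒜)) : Ideal R where
  carrier := {r : R | ∀ s : R, DirectSum.decompose 𝒜 (r * s) 0 ∈ q}
  zero_mem' s := by
    rw [zero_mul, DirectSum.decompose_zero]
    exact q.zero_mem
  add_mem' {a b} ha hb s := by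
    rw [add_mul, DirectSum.decompose_add]
    exact q.add_mem (ha s) (hb s)
  smul_mem' c r hr s := by
    rw [smul_eq_mul, mul_comm c, mul_assoc]
    exact hr (c * s)

section

variable {G : Type*} [AddCommGroup G] [DecidableEq G]
  {R : Type*} [CommRing R] (𝒜 : G → AddSubgroup R) [GradedRing 𝒜]
  (q : Ideal ↥(SetLike.GradeZero.subring 𝒜))

theorem Ideal.mem_tilde {r : R} :
    r ∈ Ideal.tilde_s3 𝒜 q ↔ ∀ s : R, DirectSum.decompose 𝒜 (r * s) 0 ∈ q :=
  Iff.rfl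

theorem DirectSum.coe_decompose_mul_zero_of_mem_neg {g : G} (r : R) {s : R} (hs : s ∈ 𝒜 (-g)) :
    (DirectSum.decompose 𝒜 (r * s) 0 : R) = DirectSum.decompose 𝒜 r g * s := by
  rw [← DirectSum.coe_decompose_mul_add_of_right_mem 𝒜 hs, add_neg_cancel]

theorem Ideal.coe_tilde : (Ideal.tilde_s3 𝒜 q : Set R) = Ideal.tildeSet 𝒜 q := by
  ext r
  constructor
  · intro hr g s hs
    exact ⟨_, hr s, DirectSum.coe_decompose_mul_zero_of_mem_neg 𝒜 r hs⟩
  · intro hr s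
    induction s using DirectSum.Decomposition.inductionOn 𝒜 with
    | zero =>
      rw [mul_zero, DirectSum.decompose_zero]
      exact q.zero_mem
    | @homogeneous i s =>
      have hs : (s : R) ∈ 𝒜 (-(-i)) := by
        rw [neg_neg]
        exact s.2
      obtain ⟨y, hy, h⟩ := hr (-i) s hs
      rw [← DirectSum.coe_decompose_mul_zero_of_mem_neg 𝒜 r hs] at h
      exact (Subtype.ext h : y = DirectSum.decompose 𝒜 (r * s) 0) ▸ hy
    | add s t hs ht =>
      rw [mul_add, DirectSum.decompose_add]
      exact q.add_mem hs ht

theorem Ideal.mem_tilde_iff_mem_tildeSet {r : R} :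
    r ∈ Ideal.tilde_s3 𝒜 q ↔ r ∈ Ideal.tildeSet 𝒜 q := by
  rw [← Ideal.coe_tilde, SetLike.mem_coe]

theorem Ideal.isHomogeneous_tilde_s3 : (Ideal.tilde_s3 𝒜 q).IsHomogeneous 𝒜 := by
  intro i r hr
  rw [Ideal.mem_tilde_iff_mem_tildeSet] at hr ⊢
  intro g s hs
  by_cases h : i = g
  · subst h
    rw [DirectSum.decompose_coe, DirectSum.of_eq_same]
    exact hr i s hs
  · rw [DirectSum.decompose_of_mem_ne 𝒜 (SetLike.coe_mem _) h, zero_mul]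
    exact ⟨0, q.zero_mem, rfl⟩

theorem Ideal.coe_mem_tilde {a : ↥(SetLike.GradeZero.subring 𝒜)} (ha : a ∈ q) :
    (a : R) ∈ Ideal.tilde_s3 𝒜 q := by
  intro s
  let b : ↥(SetLike.GradeZero.subring 𝒜) := DirectSum.decompose 𝒜 s 0
  have h : DirectSum.decompose 𝒜 ((a : R) * s) 0 = a * b := by
    apply Subtype.ext
    have := DirectSum.coe_decompose_mul_add_of_left_mem 𝒜 (j := 0) (b := s) a.2
    rwa [add_zero] at this
  rw [h]
  exact q.mul_mem_right _ ha

theorem Ideal.tilde_ne_top (hq : q ≠ ⊤) : Ideal.tilde_s3 𝒜 q ≠ ⊤ := by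
  intro h
  have h1 := (Ideal.mem_tilde 𝒜 q).1 ((Ideal.eq_top_iff_one _).1 h) 1
  rw [mul_one, DirectSum.decompose_one, DirectSum.one_def, DirectSum.of_eq_same] at h1
  exact hq ((Ideal.eq_top_iff_one q).2 h1)

theorem Ideal.degZeroPart_ne_top {J : Ideal R} (hJ : J ≠ ⊤) : Ideal.degZeroPart 𝒜 J ≠ ⊤ :=
  Ideal.comap_ne_top _ hJ

theorem Ideal.isGMaximal_tilde (hq : q.IsMaximal) : (Ideal.tilde_s3 𝒜 q).IsGMaximal 𝒜 := by
  refine ⟨Ideal.isHomogeneous_tilde_s3 𝒜 q, Ideal.tilde_ne_top 𝒜 q hq.ne_top,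
    fun J hJ hJ_top hle ↦ le_antisymm hle fun r hr s ↦ ?_⟩
  have hqJ : q = Ideal.degZeroPart 𝒜 J :=
    hq.eq_of_le (Ideal.degZeroPart_ne_top 𝒜 hJ_top) fun a ha ↦ hle (Ideal.coe_mem_tilde 𝒜 q ha)
  rw [hqJ]
  exact hJ 0 (J.mul_mem_right s hr)

end

/-!
STATEMENT 3: If `q` is a maximal ideal of the degree-zero subring `R₀`, then
`q̃ := ⊕_{g∈G} {r ∈ R_g | r·R_{−g} ⊆ q}` is a `G`-maximal ideal of `R`, i.e. a
proper homogeneous ideal maximal among proper homogeneous ideals.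
-/

theorem tilde_isGMaximal_of_isMaximal
    {G : Type*} [AddCommGroup G] [DecidableEq G]
    {R : Type*} [CommRing R] (𝒜 : G → AddSubgroup R) [GradedRing 𝒜]
    (q : Ideal ↥(SetLike.GradeZero.subring 𝒜)) (hq : q.IsMaximal) :
    ∃ I : Ideal R, (I : Set R) = Ideal.tildeSet 𝒜 q ∧ I.IsGMaximal 𝒜 :=
  ⟨Ideal.tilde_s3 𝒜 q, Ideal.coe_tilde 𝒜 q, Ideal.isGMaximal_tilde 𝒜 q hq⟩
end

section
/- Let G be an abelian group and R a nonzero commutative ring graded by G. Then R has exactly one G-maximal ideal (i.e., R is G-local) if and only if the degree-zero subring R₀ is a local ring. -/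
open DirectSum

/-- Every proper homogeneous ideal is contained in a `G`-maximal ideal. -/
theorem Ideal.IsHomogeneous.exists_le_isGMaximal
    {G : Type*} [AddCommGroup G] [DecidableEq G]
    {R : Type*} [CommRing R] {𝒜 : G → AddSubgroup R} [GradedRing 𝒜]
    {I : Ideal R} (hI : I.IsHomogeneous 𝒜) (hne : I ≠ ⊤) :
    ∃ m : Ideal R, m.IsGMaximal 𝒜 ∧ I ≤ m := by
  obtain ⟨m, hIm, hm⟩ := zorn_le_nonempty₀ {J : Ideal R | J.IsHomogeneous 𝒜 ∧ J ≠ ⊤}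
    (fun c hc hchain J hJ => by
      refine ⟨SupSet.sSup c, ⟨Ideal.IsHomogeneous.sSup fun K hK => (hc hK).1, fun htop => ?_⟩,
        fun K hK => le_sSup hK⟩
      rw [Ideal.eq_top_iff_one,
        Submodule.mem_sSup_of_directed ⟨J, hJ⟩ hchain.directedOn] at htop
      obtain ⟨K, hK, h1⟩ := htop
      exact (hc hK).2 ((Ideal.eq_top_iff_one K).2 h1))
    I ⟨hI, hne⟩
  exact ⟨m, ⟨hm.prop.1, hm.prop.2, fun J hJ hJne hle => hm.eq_of_le ⟨hJ, hJne⟩ hle⟩, hIm⟩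

/-- A degree-zero element that is invertible in `R` is invertible in `R₀`. -/
theorem SetLike.GradeZero.isUnit_of_isUnit_coe
    {G : Type*} [AddCommGroup G] [DecidableEq G]
    {R : Type*} [CommRing R] {𝒜 : G → AddSubgroup R} [GradedRing 𝒜]
    {a : SetLike.GradeZero.subring 𝒜} (ha : IsUnit (a : R)) : IsUnit a := by
  obtain ⟨r, hr⟩ := ha.exists_right_inv
  refine IsUnit.of_mul_eq_one ⟨decompose 𝒜 r 0, (decompose 𝒜 r 0).2⟩ (Subtype.ext ?_)
  have h := DirectSum.coe_decompose_mul_of_left_mem_zero 𝒜 (j := 0) (b := r) a.2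
  rw [hr, decompose_of_mem_same 𝒜 SetLike.GradedOne.one_mem] at h
  exact h.symm

/-!
STATEMENT 5: Let `R` be a nonzero commutative ring graded by `G`. Then `R` has
exactly one `G`-maximal ideal (i.e. `R` is `G`-local) if and only if the
degree-zero subring `R₀` is a local ring.
-/

theorem gLocal_iff_gradeZero_isLocalRing
    {G : Type*} [AddCommGroup G] [DecidableEq G]
    {R : Type*} [CommRing R] [Nontrivial R]
    (𝒜 : G → AddSubgroup R) [GradedRing 𝒜] :
    (∃! m : Ideal R, m.IsGMaximal 𝒜) ↔
      IsLocalRing ↥(SetLike.GradeZero.subring 𝒜) := by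
  constructor
  · rintro ⟨m, hm, huniq⟩
    have mem_of_nonunit : ∀ a : SetLike.GradeZero.subring 𝒜, ¬ IsUnit a → (a : R) ∈ m := by
      intro a ha
      have hhom : (Ideal.span {(a : R)}).IsHomogeneous 𝒜 :=
        Ideal.homogeneous_span 𝒜 _ fun x hx => ⟨0, by rw [Set.mem_singleton_iff.1 hx]; exact a.2⟩
      obtain ⟨n, hn, hle⟩ := hhom.exists_le_isGMaximal fun htop =>
        ha (SetLike.GradeZero.isUnit_of_isUnit_coe (Ideal.span_singleton_eq_top.1 htop))
      exact huniq n hn ▸ hle (Ideal.mem_span_singleton_self _)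
    refine IsLocalRing.of_nonunits_add fun a b ha hb hab => hm.2.1 ?_
    exact Ideal.eq_top_of_isUnit_mem m (m.add_mem (mem_of_nonunit a ha) (mem_of_nonunit b hb))
      (hab.map (SetLike.GradeZero.subring 𝒜).subtype)
  · intro hlocal
    have eq_top_of_isUnit : ∀ (n : Ideal R), n.IsHomogeneous 𝒜 → ∀ x ∈ n,
        IsUnit (⟨decompose 𝒜 x 0, (decompose 𝒜 x 0).2⟩ : SetLike.GradeZero.subring 𝒜) →
        n = ⊤ := fun n hn x hx hu =>
      Ideal.eq_top_of_isUnit_mem n (hn 0 hx) (hu.map (SetLike.GradeZero.subring 𝒜).subtype)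
    obtain ⟨m, hm, -⟩ := (Ideal.IsHomogeneous.bot 𝒜).exists_le_isGMaximal bot_ne_top
    refine ⟨m, hm, fun n hn => ?_⟩
    by_cases htop : n ⊔ m = ⊤
    · obtain ⟨x, hx, y, hy, hxy⟩ := Submodule.mem_sup.1 ((Ideal.eq_top_iff_one _).1 htop)
      have hsum : (⟨decompose 𝒜 x 0, (decompose 𝒜 x 0).2⟩ : SetLike.GradeZero.subring 𝒜) +
          ⟨decompose 𝒜 y 0, (decompose 𝒜 y 0).2⟩ = 1 := by
        have h := decompose_of_mem_same 𝒜 (SetLike.GradedOne.one_mem (A := 𝒜))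
        rw [← hxy, decompose_add] at h
        exact Subtype.ext (h.trans hxy)
      rcases IsLocalRing.isUnit_or_isUnit_of_add_one hsum with hu | hu
      · exact absurd (eq_top_of_isUnit n hn.1 x hx hu) hn.2.1
      · exact absurd (eq_top_of_isUnit m hm.1 y hy hu) hm.2.1
    · have hsup := hn.1.sup hm.1
      exact (hn.2.2 _ hsup htop le_sup_left).trans (hm.2.2 _ hsup htop le_sup_right).symm
end

section
/- Let G be an abelian group, R a commutative ring graded by G, and m a G-maximal ideal of R. Then the set {g ∈ G : there exists x ∈ R_g with x ∉ m} (the support of the graded quotient R/m) is a subgroup of G. -/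
/-- A homogeneous element outside a `G`-maximal ideal `m` is invertible modulo `m`, with an
inverse that is homogeneous of the opposite degree. -/
theorem Ideal.IsGMaximal.exists_mul_sub_one_mem
    {G : Type*} [AddCommGroup G] [DecidableEq G]
    {R : Type*} [CommRing R] {𝒜 : G → AddSubgroup R} [GradedRing 𝒜]
    {m : Ideal R} (hm : m.IsGMaximal 𝒜) {g : G} {x : R} (hx : x ∈ 𝒜 g) (hxm : x ∉ m) :
    ∃ y ∈ 𝒜 (-g), y * x - 1 ∈ m := by
  obtain ⟨hhom, -, hmax⟩ := hm
  have hspan : (Ideal.span {x}).IsHomogeneous 𝒜 :=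
    Ideal.homogeneous_span 𝒜 _ (by rintro _ rfl; exact ⟨g, hx⟩)
  have htop : Ideal.span {x} ⊔ m = ⊤ := by
    by_contra hne
    refine hxm ?_
    rw [hmax _ (hspan.sup hhom) hne le_sup_right]
    exact Ideal.mem_sup_left (Ideal.mem_span_singleton_self x)
  obtain ⟨r, a, ha, h1⟩ := Ideal.mem_span_singleton_sup.mp ((Ideal.eq_top_iff_one _).mp htop)
  refine ⟨DirectSum.decompose 𝒜 r (-g), SetLike.coe_mem _, ?_⟩
  have hmul := DirectSum.coe_decompose_mul_add_of_right_mem 𝒜 (a := r) (i := -g) hx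
  rw [neg_add_cancel] at hmul
  have hone : (DirectSum.decompose 𝒜 (1 : R) 0 : R) = 1 :=
    DirectSum.decompose_of_mem_same 𝒜 SetLike.GradedOne.one_mem
  rw [← hmul, ← hone, ← h1, DirectSum.decompose_add, DirectSum.add_apply, AddSubgroup.coe_add,
    sub_add_cancel_left]
  exact m.neg_mem (hhom 0 ha)

/-!
STATEMENT 8: Let `m` be a `G`-maximal ideal of `R`. Then the set
`{g ∈ G : ∃ x ∈ R_g, x ∉ m}` (the support of the graded quotient `R/m`) is a
subgroup of `G`.
-/

theorem support_of_quotient_gMaximal_isAddSubgroup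
    {G : Type*} [AddCommGroup G] [DecidableEq G]
    {R : Type*} [CommRing R] (𝒜 : G → AddSubgroup R) [GradedRing 𝒜]
    (m : Ideal R) (hm : m.IsGMaximal 𝒜) :
    ∃ H : AddSubgroup G, (H : Set G) = { g : G | ∃ x ∈ 𝒜 g, x ∉ m } := by
  have h_one : (1 : R) ∉ m := (Ideal.ne_top_iff_one m).mp hm.2.1
  refine ⟨{ carrier := { g : G | ∃ x ∈ 𝒜 g, x ∉ m }
            add_mem' := ?_
            zero_mem' := ?_
            neg_mem' := ?_ }, rfl⟩
  · rintro g h ⟨x, hx, hxm⟩ ⟨y, hy, hym⟩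
    refine ⟨x * y, SetLike.GradedMul.mul_mem hx hy, fun hxy => hym ?_⟩
    obtain ⟨z, -, hz⟩ := hm.exists_mul_sub_one_mem hx hxm
    have key : z * (x * y) - y * (z * x - 1) ∈ m :=
      m.sub_mem (m.mul_mem_left _ hxy) (m.mul_mem_left _ hz)
    convert key using 1
    ring
  · exact ⟨1, SetLike.GradedOne.one_mem, h_one⟩
  · rintro g ⟨x, hx, hxm⟩
    obtain ⟨y, hy, hyx⟩ := hm.exists_mul_sub_one_mem hx hxm
    refine ⟨y, hy, fun hym => h_one ?_⟩
    have key : x * y - (y * x - 1) ∈ m := m.sub_mem (m.mul_mem_left _ hym) hyx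
    convert key using 1
    ring
end

section
/- Let G be an abelian group, R a commutative ring graded by G, m a G-maximal ideal of R, g ∈ G, and x ∈ R_g with x ∉ m. Then for every h ∈ G, the map sending s + (m ∩ R_h) to xs + (m ∩ R_{g+h}) is a well-defined additive bijection from R_h/(m ∩ R_h) to R_{g+h}/(m ∩ R_{g+h}). (Thus multiplication by x gives an isomorphism R/m ≅ (R/m)(g) of G-graded R-modules whenever the degree-g component of R/m is nonzero.) -/
/-!
STATEMENT 9: Let `m` be a `G`-maximal ideal of `R`, `g ∈ G`, and `x ∈ R_g` with
`x ∉ m`. Then for every `h ∈ G`, the map `s + (m ∩ R_h) ↦ x·s + (m ∩ R_{g+h})` is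
a well-defined additive bijection `R_h/(m ∩ R_h) → R_{g+h}/(m ∩ R_{g+h})`.
-/

/-- Modulo a `G`-maximal ideal, a homogeneous element of degree `g` outside the ideal has a
homogeneous inverse of degree `-g`. -/
theorem Ideal.IsGMaximal.exists_one_sub_mul_mem
    {G : Type*} [AddCommGroup G] [DecidableEq G]
    {R : Type*} [CommRing R] {𝒜 : G → AddSubgroup R} [GradedRing 𝒜]
    {m : Ideal R} (hm : m.IsGMaximal 𝒜)
    {g : G} {x : R} (hx : x ∈ 𝒜 g) (hxm : x ∉ m) :
    ∃ y ∈ 𝒜 (-g), 1 - y * x ∈ m := by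
  obtain ⟨hhom, -, hmax⟩ := hm
  have hspan : (Ideal.span {x}).IsHomogeneous 𝒜 :=
    Ideal.homogeneous_span 𝒜 {x} (by rintro _ rfl; exact ⟨g, hx⟩)
  have htop : m ⊔ Ideal.span {x} = ⊤ := by
    by_contra hne
    have heq := hmax _ (hhom.sup hspan) hne le_sup_left
    exact hxm (heq ▸ Ideal.mem_sup_right (Ideal.mem_span_singleton_self x))
  obtain ⟨a, ha, b, hb, hab⟩ := Submodule.mem_sup.mp ((Ideal.eq_top_iff_one _).mp htop)
  obtain ⟨r, rfl⟩ := Ideal.mem_span_singleton'.mp hb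
  refine ⟨DirectSum.decompose 𝒜 r (-g), SetLike.coe_mem _, ?_⟩
  have hone : (DirectSum.decompose 𝒜 (1 : R) 0 : R) = 1 :=
    DirectSum.decompose_of_mem_same 𝒜 SetLike.GradedOne.one_mem
  have hmul : (DirectSum.decompose 𝒜 (r * x) 0 : R) = DirectSum.decompose 𝒜 r (-g) * x := by
    rw [← DirectSum.coe_decompose_mul_add_of_right_mem 𝒜 hx, neg_add_cancel]
  have hcomp := hhom 0 ha
  rwa [eq_sub_of_add_eq hab, DirectSum.decompose_sub, DirectSum.sub_apply,
    AddSubgroup.coe_sub, hone, hmul] at hcomp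

theorem mul_induces_addEquiv_on_quotients
    {G : Type*} [AddCommGroup G] [DecidableEq G]
    {R : Type*} [CommRing R] (𝒜 : G → AddSubgroup R) [GradedRing 𝒜]
    (m : Ideal R) (hm : m.IsGMaximal 𝒜)
    (g : G) (x : R) (hx : x ∈ 𝒜 g) (hxm : x ∉ m) (h : G) :
    ∃ f : (↥(𝒜 h) ⧸ ((m.toAddSubgroup).addSubgroupOf (𝒜 h))) ≃+
          (↥(𝒜 (g + h)) ⧸ ((m.toAddSubgroup).addSubgroupOf (𝒜 (g + h)))),
      ∀ s : ↥(𝒜 h),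
        f (QuotientAddGroup.mk s) =
          QuotientAddGroup.mk
            (⟨x * (s : R), SetLike.mul_mem_graded hx s.2⟩ : ↥(𝒜 (g + h))) := by
  obtain ⟨y, hy, hxy⟩ := hm.exists_one_sub_mul_mem hx hxm
  let φ : ↥(𝒜 h) →+ ↥(𝒜 (g + h)) :=
    { toFun := fun s => ⟨x * (s : R), SetLike.mul_mem_graded hx s.2⟩
      map_zero' := Subtype.ext (mul_zero x)
      map_add' := fun s t => Subtype.ext (mul_add x s t) }
  have hφ : (m.toAddSubgroup).addSubgroupOf (𝒜 h) ≤
      ((m.toAddSubgroup).addSubgroupOf (𝒜 (g + h))).comap φ :=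
    fun s hs => m.mul_mem_left x hs
  refine ⟨AddEquiv.ofBijective (QuotientAddGroup.map _ _ φ hφ) ⟨?_, ?_⟩, fun s => rfl⟩
  · rw [injective_iff_map_eq_zero]
    intro q hq
    obtain ⟨s, rfl⟩ := QuotientAddGroup.mk_surjective q
    have hxs : x * (s : R) ∈ m := (QuotientAddGroup.eq_zero_iff (φ s)).mp hq
    refine (QuotientAddGroup.eq_zero_iff s).mpr (show (s : R) ∈ m from ?_)
    convert m.add_mem (m.mul_mem_left (s : R) hxy) (m.mul_mem_left y hxs) using 1
    ring
  · intro q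
    obtain ⟨t, rfl⟩ := QuotientAddGroup.mk_surjective q
    have hyt : y * (t : R) ∈ 𝒜 h := by
      simpa using SetLike.mul_mem_graded hy t.2
    refine ⟨QuotientAddGroup.mk ⟨y * t, hyt⟩, QuotientAddGroup.eq.mpr ?_⟩
    change -(x * (y * (t : R))) + t ∈ m
    convert m.mul_mem_left (t : R) hxy using 1
    ring
end

section
/- Let π : T → U be a covering functor between idempotent-complete triangulated categories such that the image of π generates U (i.e., the smallest thick subcategory of U containing all objects πX, X ∈ T, is U itself), and let B be a full subcategory of U contained in the image of π. Then B is a silting subcategory of U if and only if π⁻¹B is a silting subcategory of T. -/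
open CategoryTheory CategoryTheory.Limits CategoryTheory.Pretriangulated
open ZeroObject DirectSum

section Defs

variable (C : Type*) [Category C] [Preadditive C] [HasZeroObject C]
  [HasShift C ℤ] [∀ n : ℤ, (shiftFunctor C n).Additive] [Pretriangulated C]

/-- A set of objects `P` of a (pre)triangulated category is *thick* if it is the
class of objects of a full triangulated subcategory closed under direct summands:
it is closed under isomorphisms, contains `0`, is closed under shifts, under
extensions (in distinguished triangles), and under direct summands (retracts). -/
def IsThickSet (P : Set C) : Prop :=
  (∀ ⦃X Y : C⦄, (X ≅ Y) → X ∈ P → Y ∈ P) ∧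
  ((0 : C) ∈ P) ∧
  (∀ (X : C) (n : ℤ), X ∈ P → (X⟦n⟧ : C) ∈ P) ∧
  (∀ T : Triangle C, (T ∈ distTriang C) → T.obj₁ ∈ P → T.obj₃ ∈ P → T.obj₂ ∈ P) ∧
  (∀ X Y : C, (∃ (i : X ⟶ Y) (r : Y ⟶ X), i ≫ r = 𝟙 X) → Y ∈ P → X ∈ P)

/-- A set of objects `S` *generates* the triangulated category `C` if the smallest
thick subcategory of `C` containing `S` is all of `C`. -/
def GeneratesTriang (S : Set C) : Prop :=
  ∀ P : Set C, IsThickSet C P → S ⊆ P → ∀ X : C, X ∈ P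

/-- A (full) subcategory `B` is *presilting* if `Hom(B, B′[i]) = 0` for all
`B, B′ ∈ B` and all integers `i > 0`. -/
def IsPresiltingSet (B : Set C) : Prop :=
  ∀ X ∈ B, ∀ Y ∈ B, ∀ i : ℤ, 0 < i → ∀ f : X ⟶ (Y⟦i⟧), f = 0

/-- A (full) subcategory `B` is *pretilting* if `Hom(B, B′[i]) = 0` for all
`B, B′ ∈ B` and all integers `i ≠ 0`. -/
def IsPretiltingSet (B : Set C) : Prop :=
  ∀ X ∈ B, ∀ Y ∈ B, ∀ i : ℤ, i ≠ 0 → ∀ f : X ⟶ (Y⟦i⟧), f = 0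

/-- `B` is silting if it is presilting and generates. -/
def IsSiltingSet (B : Set C) : Prop :=
  IsPresiltingSet C B ∧ GeneratesTriang C B

/-- `B` is tilting if it is pretilting and generates. -/
def IsTiltingSet (B : Set C) : Prop :=
  IsPretiltingSet C B ∧ GeneratesTriang C B

end Defs

section Covering

variable {T : Type*} [Category T] [Preadditive T]
  {U : Type*} [Category U] [Preadditive U]

/-- The canonical map `⊕_{Y′ : πY′ = πY} Hom_T(X, Y′) → Hom_U(πX, πY)` whose
components are given by applying `π` (and identifying `πY′` with `πY`). -/
noncomputable def coveringMapRight (F : T ⥤ U) [F.Additive] (X Y : T) :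
    (⨁ (Y' : {Y' : T // F.obj Y' = F.obj Y}), (X ⟶ (Y' : T))) →+
      (F.obj X ⟶ F.obj Y) := by
  classical
  exact DirectSum.toAddMonoid fun Y' =>
    { toFun := fun f => F.map f ≫ eqToHom Y'.2
      map_zero' := by simp
      map_add' := fun f g => by rw [F.map_add, Preadditive.add_comp] }

/-- The canonical map `⊕_{X′ : πX′ = πX} Hom_T(X′, Y) → Hom_U(πX, πY)` whose
components are given by applying `π` (and identifying `πX′` with `πX`). -/
noncomputable def coveringMapLeft (F : T ⥤ U) [F.Additive] (X Y : T) :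
    (⨁ (X' : {X' : T // F.obj X' = F.obj X}), ((X' : T) ⟶ Y)) →+
      (F.obj X ⟶ F.obj Y) := by
  classical
  exact DirectSum.toAddMonoid fun X' =>
    { toFun := fun f => eqToHom X'.2.symm ≫ F.map f
      map_zero' := by simp
      map_add' := fun f g => by rw [F.map_add, Preadditive.comp_add] }

/-- An additive functor `π : T → U` is a *covering functor* if for all objects
`X, Y` of `T` the two canonical maps
`⊕_{Y′ : πY′=πY} Hom_T(X,Y′) → Hom_U(πX,πY)` and
`⊕_{X′ : πX′=πX} Hom_T(X′,Y) → Hom_U(πX,πY)` are bijective. -/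
def IsCoveringFunctor (F : T ⥤ U) [F.Additive] : Prop :=
  (∀ X Y : T, Function.Bijective (coveringMapRight F X Y)) ∧
  (∀ X Y : T, Function.Bijective (coveringMapLeft F X Y))

end Covering

/-!
STATEMENT 10: Let `π : T → U` be a covering functor between idempotent-complete
triangulated categories such that the image of `π` generates `U`, and let `B` be a
full subcategory of `U` contained in the image of `π`. Then `B` is a silting
subcategory of `U` if and only if `π⁻¹B` is a silting subcategory of `T`.
-/

section CoveringFunctor

variable {T : Type*} [Category T] [Preadditive T]
  {U : Type*} [Category U] [Preadditive U]

lemma coveringMapRight_of (F : T ⥤ U) [F.Additive] [DecidableEq T] (X Y : T)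
    (Y' : {Y' : T // F.obj Y' = F.obj Y}) (f : X ⟶ (Y' : T)) :
    coveringMapRight F X Y (DirectSum.of (fun Z : {Y' : T // F.obj Y' = F.obj Y} => X ⟶ (Z : T))
      Y' f) = F.map f ≫ eqToHom Y'.2 := by
  unfold coveringMapRight
  convert DirectSum.toAddMonoid_of (β := fun Z : {Y' : T // F.obj Y' = F.obj Y} => X ⟶ (Z : T))
    _ Y' f
  rfl

/-- A covering functor admits retractions `Hom(F X, F Y) → Hom(X, Y)` of its action on
morphisms, compatible with precomposition by morphisms of the source category. -/
lemma IsCoveringFunctor.exists_retraction {F : T ⥤ U} [F.Additive] (hF : IsCoveringFunctor F)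
    (Y : T) : ∃ p : ∀ X : T, (F.obj X ⟶ F.obj Y) → (X ⟶ Y),
      (∀ (X : T) (f : X ⟶ Y), p X (F.map f) = f) ∧
      (∀ (X X' : T) (q : X ⟶ X') (f : F.obj X' ⟶ F.obj Y),
        p X (F.map q ≫ f) = q ≫ p X' f) := by
  classical
  let e (X : T) := AddEquiv.ofBijective (coveringMapRight F X Y) (hF.1 X Y)
  have h_map (X : T) (x) : (e X).symm (coveringMapRight F X Y x) = x := (e X).symm_apply_apply x
  refine ⟨fun X f => (e X).symm f ⟨Y, rfl⟩, fun X f => ?_, fun X X' q f => ?_⟩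
  · have h := coveringMapRight_of F X Y ⟨Y, rfl⟩ f
    rw [eqToHom_refl, Category.comp_id] at h
    dsimp only
    rw [← h, h_map, DirectSum.of_eq_same]
  · obtain ⟨x, rfl⟩ := (hF.1 X' Y).2 f
    dsimp only
    rw [h_map]
    induction x using DirectSum.induction_on with
    | zero => simp
    | of Z g =>
      rw [coveringMapRight_of, ← Category.assoc, ← F.map_comp, ← coveringMapRight_of, h_map]
      by_cases hZ : Z = ⟨Y, rfl⟩
      · subst hZ
        rw [DirectSum.of_eq_same, DirectSum.of_eq_same]
      · rw [DirectSum.of_eq_of_ne _ _ _ (Ne.symm hZ), DirectSum.of_eq_of_ne _ _ _ (Ne.symm hZ),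
          comp_zero]
    | add x y hx hy =>
      rw [map_add, Preadditive.comp_add, map_add, DirectSum.add_apply, hx, hy,
        DirectSum.add_apply, Preadditive.comp_add]

/-- For a covering functor, if an identity `𝟙 (F X)` factors through the image of `q : X ⟶ V`,
then `X` is a retract of `V`. -/
lemma IsCoveringFunctor.exists_section {F : T ⥤ U} [F.Additive] (hF : IsCoveringFunctor F)
    {X V : T} (q : X ⟶ V) (g : F.obj V ⟶ F.obj X) (h : F.map q ≫ g = 𝟙 (F.obj X)) :
    ∃ r : V ⟶ X, q ≫ r = 𝟙 X := by
  obtain ⟨p, hp, hp'⟩ := hF.exists_retraction X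
  refine ⟨p V g, ?_⟩
  rw [← hp', h, ← F.map_id, hp]

lemma IsCoveringFunctor.map_injective {F : T ⥤ U} [F.Additive] (hF : IsCoveringFunctor F)
    {X Y : T} {f : X ⟶ Y} (h : F.map f = 0) : f = 0 := by
  obtain ⟨p, hp, -⟩ := hF.exists_retraction Y
  rw [← hp X f, h, ← F.map_zero, hp]

/-- For a covering functor, a morphism `F X ⟶ F Y` factors through the image of a morphism from
`X` to any class of objects containing the fibre over `F Y` and closed under finite sums. -/
lemma IsCoveringFunctor.exists_factorization [HasZeroObject T] [HasBinaryBiproducts T]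
    {F : T ⥤ U} [F.Additive]
    (hF : IsCoveringFunctor F) {P : Set T} (h_zero : (0 : T) ∈ P)
    (h_biprod : ∀ A B : T, A ∈ P → B ∈ P → (A ⊞ B) ∈ P) {X Y : T}
    (hY : ∀ Y' : T, F.obj Y' = F.obj Y → Y' ∈ P) (f : F.obj X ⟶ F.obj Y) :
    ∃ V ∈ P, ∃ (q : X ⟶ V) (g : F.obj V ⟶ F.obj Y), f = F.map q ≫ g := by
  classical
  obtain ⟨x, rfl⟩ := (hF.1 X Y).2 f
  induction x using DirectSum.induction_on with
  | zero => exact ⟨0, h_zero, 0, 0, by simp⟩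
  | of Z g => exact ⟨Z, hY Z Z.2, g, eqToHom Z.2, coveringMapRight_of F X Y Z g⟩
  | add x y hx hy =>
    obtain ⟨V, hV, q, g, h⟩ := hx
    obtain ⟨V', hV', q', g', h'⟩ := hy
    refine ⟨V ⊞ V', h_biprod _ _ hV hV', biprod.lift q q',
      F.map biprod.fst ≫ g + F.map biprod.snd ≫ g', ?_⟩
    rw [map_add, h, h', Preadditive.comp_add, ← F.map_comp_assoc, ← F.map_comp_assoc,
      biprod.lift_fst, biprod.lift_snd]

/-- A class of objects closed under finite sums and retracts which contains the fibre of a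
covering functor over `F Y` contains every `Z` with `F Z ≅ F Y`. -/
lemma IsCoveringFunctor.mem_of_iso [HasZeroObject T] [HasBinaryBiproducts T]
    {F : T ⥤ U} [F.Additive]
    (hF : IsCoveringFunctor F) {P : Set T} (h_zero : (0 : T) ∈ P)
    (h_biprod : ∀ A B : T, A ∈ P → B ∈ P → (A ⊞ B) ∈ P)
    (h_retract : ∀ A B : T, (∃ (i : A ⟶ B) (r : B ⟶ A), i ≫ r = 𝟙 A) → B ∈ P → A ∈ P)
    {Y Z : T} (hY : ∀ Y' : T, F.obj Y' = F.obj Y → Y' ∈ P) (e : F.obj Z ≅ F.obj Y) : Z ∈ P := by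
  obtain ⟨V, hV, q, g, h⟩ := hF.exists_factorization h_zero h_biprod hY e.hom
  obtain ⟨r, hr⟩ := hF.exists_section q (g ≫ e.inv) (by rw [← Category.assoc, ← h, e.hom_inv_id])
  exact h_retract Z V ⟨q, r, hr⟩ hV

lemma IsCoveringFunctor.presilting_preimage [HasShift T ℤ] [HasShift U ℤ] {F : T ⥤ U}
    [F.Additive] [F.CommShift ℤ] (hF : IsCoveringFunctor F) {B : Set U}
    (h : IsPresiltingSet U B) : IsPresiltingSet T (F.obj ⁻¹' B) := by
  intro X hX Y hY i hi f
  apply hF.map_injective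
  rw [← cancel_mono ((F.commShiftIso i).hom.app Y), zero_comp]
  exact h _ hX _ hY i hi _

end CoveringFunctor

section Triangulated

variable {T : Type*} [Category T] [Preadditive T] [HasZeroObject T] [HasShift T ℤ]
  [∀ n : ℤ, (shiftFunctor T n).Additive] [Pretriangulated T]

lemma IsThickSet.biprod_mem {P : Set T} (hP : IsThickSet T P) (A B : T) (hA : A ∈ P)
    (hB : B ∈ P) : (A ⊞ B) ∈ P :=
  hP.2.2.2.1 _ (binaryBiproductTriangle_distinguished A B) hA hB

variable {U : Type*} [Category U]

/-- The objects `Y` such that every morphism `F X ⟶ Y` factors as `F q ≫ g` where the target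
of `q` belongs to `P`. -/
def factoringSet (F : T ⥤ U) (P : Set T) : Set U :=
  {Y | ∀ (X : T) (f : F.obj X ⟶ Y), ∃ V ∈ P, ∃ (q : X ⟶ V) (g : F.obj V ⟶ Y), f = F.map q ≫ g}

variable [HasShift U ℤ]

lemma IsThickSet.shift_mem_factoringSet {F : T ⥤ U} [F.CommShift ℤ] {P : Set T}
    (hP : IsThickSet T P) {Y : U} (hY : Y ∈ factoringSet F P) (n : ℤ) :
    (Y⟦n⟧ : U) ∈ factoringSet F P := by
  intro X f
  let e := (shiftFunctor T n).objObjPreimageIso X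
  obtain ⟨k, hk⟩ := (shiftFunctor U n).map_surjective
    ((F.commShiftIso n).inv.app ((shiftFunctor T n).objPreimage X) ≫ F.map e.hom ≫ f)
  obtain ⟨V, hV, q, g, rfl⟩ := hY _ k
  refine ⟨V⟦n⟧, hP.2.2.1 V n hV, e.inv ≫ q⟦n⟧', (F.commShiftIso n).hom.app V ≫ g⟦n⟧', ?_⟩
  have h_nat := (F.commShiftIso n).hom.naturality q
  dsimp at h_nat
  rw [F.map_comp, Category.assoc, reassoc_of% h_nat, ← Functor.map_comp, hk,
    Iso.hom_inv_id_app_assoc, ← F.map_comp_assoc, e.inv_hom_id, F.map_id, Category.id_comp]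

variable [Preadditive U] [HasZeroObject U]
  [∀ n : ℤ, (shiftFunctor U n).Additive] [Pretriangulated U]
  {F : T ⥤ U} [F.CommShift ℤ] [F.IsTriangulated]

lemma IsThickSet.preimage {P : Set U} (hP : IsThickSet U P) : IsThickSet T (F.obj ⁻¹' P) := by
  obtain ⟨h_iso, h_zero, h_shift, h_ext, h_retract⟩ := hP
  refine ⟨fun X Y e hX => h_iso (F.mapIso e) hX, h_iso F.mapZeroObject.symm h_zero,
    fun X n hX => h_iso ((F.commShiftIso n).app X).symm (h_shift _ n hX),
    fun K hK h₁ h₃ => h_ext _ (F.map_distinguished K hK) h₁ h₃, ?_⟩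
  rintro X Y ⟨i, r, h⟩ hY
  exact h_retract _ _ ⟨F.map i, F.map r, by rw [← F.map_comp, h, F.map_id]⟩ hY

lemma IsThickSet.ext_mem_factoringSet {P : Set T} (hP : IsThickSet T P) (K : Triangle U)
    (hK : K ∈ distTriang U) (h₁ : K.obj₁ ∈ factoringSet F P) (h₃ : K.obj₃ ∈ factoringSet F P) :
    K.obj₂ ∈ factoringSet F P := by
  intro X f
  obtain ⟨V₃, hV₃, q₃, g₃, h_comp⟩ := h₃ X (f ≫ K.mor₂)
  obtain ⟨W, a, c, hW⟩ := distinguished_cocone_triangle₁ q₃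
  have h_zero : F.map q₃ ≫ g₃ ≫ K.mor₃ = 0 := by
    rw [← Category.assoc, ← h_comp, Category.assoc, comp_distTriang_mor_zero₂₃ _ hK, comp_zero]
  obtain ⟨k', hk'⟩ : ∃ k' : (F.obj W)⟦(1 : ℤ)⟧ ⟶ K.obj₁⟦(1 : ℤ)⟧,
      g₃ ≫ K.mor₃ = (F.map c ≫ (F.commShiftIso (1 : ℤ)).hom.app W) ≫ k' :=
    Triangle.yoneda_exact₃ _ (F.map_distinguished _ hW) (g₃ ≫ K.mor₃) h_zero
  obtain ⟨k, rfl⟩ := (shiftFunctor U (1 : ℤ)).map_surjective k'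
  obtain ⟨V₁, hV₁, q₁, g₁, rfl⟩ := h₁ W k
  obtain ⟨V, i, p, hV⟩ := distinguished_cocone_triangle₂ (c ≫ q₁⟦(1 : ℤ)⟧')
  obtain ⟨b, hb⟩ : ∃ b : X ⟶ V, q₃ = b ≫ p := by
    obtain ⟨b, -, hb⟩ := complete_distinguished_triangle_morphism₂ _ _ hW hV q₁ (𝟙 V₃)
      (Category.id_comp (c ≫ q₁⟦(1 : ℤ)⟧')).symm
    exact ⟨b, (Category.comp_id q₃).symm.trans hb⟩
  have h_nat : F.map (q₁⟦(1 : ℤ)⟧') ≫ (F.commShiftIso (1 : ℤ)).hom.app V₁ =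
      (F.commShiftIso (1 : ℤ)).hom.app W ≫ (F.map q₁)⟦(1 : ℤ)⟧' :=
    (F.commShiftIso (1 : ℤ)).hom.naturality q₁
  have h_conn : (F.map (c ≫ q₁⟦(1 : ℤ)⟧') ≫ (F.commShiftIso (1 : ℤ)).hom.app V₁) ≫
      g₁⟦(1 : ℤ)⟧' = g₃ ≫ K.mor₃ := by
    rw [hk', F.map_comp, Category.assoc, Category.assoc, Category.assoc, reassoc_of% h_nat,
      Functor.map_comp]
  obtain ⟨g, hg⟩ : ∃ g : F.obj V ⟶ K.obj₂, F.map p ≫ g₃ = g ≫ K.mor₂ := by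
    obtain ⟨g, -, hg⟩ := complete_distinguished_triangle_morphism₂ _ _
      (F.map_distinguished _ hV) hK g₁ g₃ h_conn
    exact ⟨g, hg⟩
  obtain ⟨d, hd⟩ := Triangle.coyoneda_exact₂ _ hK (f - F.map b ≫ g) (by
    rw [Preadditive.sub_comp, h_comp, Category.assoc, ← hg, ← F.map_comp_assoc, ← hb,
      sub_self])
  obtain ⟨V', hV', q', g', rfl⟩ := h₁ X d
  refine ⟨V ⊞ V', hP.biprod_mem _ _ (hP.2.2.2.1 _ hV hV₁ hV₃) hV', biprod.lift b q',
    F.map biprod.fst ≫ g + F.map biprod.snd ≫ g' ≫ K.mor₁, ?_⟩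
  rw [Preadditive.comp_add, ← F.map_comp_assoc, ← F.map_comp_assoc, biprod.lift_fst,
    biprod.lift_snd, ← Category.assoc (F.map q'), ← hd, add_sub_cancel]

lemma IsThickSet.factoringSet {P : Set T} (hP : IsThickSet T P) :
    IsThickSet U (factoringSet F P) := by
  refine ⟨fun Y Y' e hY X f => ?_, fun X f => ⟨0, hP.2.1, 0, 0, (isZero_zero U).eq_of_tgt _ _⟩,
    fun Y n hY => hP.shift_mem_factoringSet hY n, hP.ext_mem_factoringSet, ?_⟩
  · obtain ⟨V, hV, q, g, h⟩ := hY X (f ≫ e.inv)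
    exact ⟨V, hV, q, g ≫ e.hom, by rw [← Category.assoc, ← h, Category.assoc, e.inv_hom_id,
      Category.comp_id]⟩
  · rintro Y Y' ⟨i, r, hir⟩ hY' X f
    obtain ⟨V, hV, q, g, h⟩ := hY' X (f ≫ i)
    exact ⟨V, hV, q, g ≫ r, by rw [← Category.assoc, ← h, Category.assoc, hir,
      Category.comp_id]⟩

/-- The preimage of a generating class under a covering functor is generating. -/
lemma IsCoveringFunctor.generates_preimage [F.Additive] (hF : IsCoveringFunctor F)
    {B : Set U} (hB : ∀ Y ∈ B, ∃ X : T, F.obj X = Y) (h_gen : GeneratesTriang U B) :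
    GeneratesTriang T (F.obj ⁻¹' B) := by
  intro P hP hBP X
  obtain ⟨V, hV, q, g, h⟩ := h_gen (factoringSet F P) hP.factoringSet (by
    intro Y hY X f
    obtain ⟨Y, rfl⟩ := hB Y hY
    refine hF.exists_factorization hP.2.1 hP.biprod_mem (fun Y' hY' => hBP ?_) f
    rwa [Set.mem_preimage, hY']) (F.obj X) X (𝟙 _)
  obtain ⟨r, hr⟩ := hF.exists_section q g h.symm
  exact hP.2.2.2.2 X V ⟨q, r, hr⟩ hV

lemma GeneratesTriang.of_preimage {B : Set U} (h_range : GeneratesTriang U (Set.range F.obj))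
    (h_gen : GeneratesTriang T (F.obj ⁻¹' B)) : GeneratesTriang U B := by
  intro P hP hBP
  refine h_range P hP ?_
  rintro _ ⟨X, rfl⟩
  exact h_gen _ (hP.preimage (F := F)) (Set.preimage_mono hBP) X

lemma IsCoveringFunctor.presilting_of_preimage [F.Additive] (hF : IsCoveringFunctor F)
    {B : Set U} (hB : ∀ Y ∈ B, ∃ X : T, F.obj X = Y) (h : IsPresiltingSet T (F.obj ⁻¹' B)) :
    IsPresiltingSet U B := by
  intro X hX Y hY i hi f
  obtain ⟨X, rfl⟩ := hB X hX
  obtain ⟨Y, rfl⟩ := hB Y hY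
  let P : Set T := {Z | ∀ g : X ⟶ Z, g = 0}
  have h_zero : (0 : T) ∈ P := fun g => (isZero_zero T).eq_of_tgt _ _
  have h_biprod (A C : T) (hA : A ∈ P) (hC : C ∈ P) : (A ⊞ C) ∈ P := fun g => by
    ext
    · exact (hA _).trans zero_comp.symm
    · exact (hC _).trans zero_comp.symm
  have h_retract (A C : T) : (∃ (i : A ⟶ C) (r : C ⟶ A), i ≫ r = 𝟙 A) → C ∈ P → A ∈ P := by
    rintro ⟨i, r, hir⟩ hC g
    rw [← Category.comp_id g, ← hir, ← Category.assoc, hC (g ≫ i), zero_comp]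
  have h_fibre (Z : T) (hZ : F.obj Z = F.obj (Y⟦i⟧)) : Z ∈ P := by
    let e := (shiftFunctor T i).objObjPreimageIso Z
    let e' : F.obj ((shiftFunctor T i).objPreimage Z) ≅ F.obj Y :=
      (shiftFunctor U i).preimageIso (((F.commShiftIso i).app _).symm ≪≫ F.mapIso e ≪≫
        eqToIso hZ ≪≫ (F.commShiftIso i).app Y)
    have h_mem : (shiftFunctor T i).objPreimage Z ∈ {A : T | (A⟦i⟧ : T) ∈ P} := by
      refine hF.mem_of_iso ?_ (fun A C hA hC => ?_) ?_ (fun Y' hY' => ?_) e'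
      · exact fun g => ((shiftFunctor T i).map_isZero (isZero_zero T)).eq_of_tgt _ _
      · intro g
        rw [← Category.comp_id g, ← (shiftFunctor T i).map_id, ← biprod.total, Functor.map_add,
          Functor.map_comp, Functor.map_comp, Preadditive.comp_add, ← Category.assoc,
          ← Category.assoc, hA (g ≫ _), hC (g ≫ _), zero_comp, zero_comp, add_zero]
      · rintro A C ⟨j, r, hjr⟩ hC
        exact h_retract _ _ ⟨j⟦i⟧', r⟦i⟧', by
          rw [← Functor.map_comp, hjr, CategoryTheory.Functor.map_id]⟩ hC
      · exact h X hX Y' (by rwa [Set.mem_preimage, hY']) i hi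
    exact h_retract _ _ ⟨e.inv, e.hom, e.inv_hom_id⟩ h_mem
  obtain ⟨V, hV, q, g, hq⟩ := hF.exists_factorization h_zero h_biprod h_fibre
    (f ≫ (F.commShiftIso i).inv.app Y)
  rw [hV q, F.map_zero, zero_comp] at hq
  rwa [← cancel_mono ((F.commShiftIso i).inv.app Y), zero_comp]

end Triangulated

theorem silting_iff_preimage_silting
    {T : Type*} [Category T] [Preadditive T] [HasZeroObject T] [HasShift T ℤ]
    [∀ n : ℤ, (shiftFunctor T n).Additive] [Pretriangulated T]
    [IsIdempotentComplete T]
    {U : Type*} [Category U] [Preadditive U] [HasZeroObject U] [HasShift U ℤ]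
    [∀ n : ℤ, (shiftFunctor U n).Additive] [Pretriangulated U]
    [IsIdempotentComplete U]
    (F : T ⥤ U) [F.Additive] [F.CommShift ℤ] [F.IsTriangulated]
    (hcov : IsCoveringFunctor F)
    (hgen : GeneratesTriang U (Set.range F.obj))
    (B : Set U) (hB : ∀ Y ∈ B, ∃ X : T, F.obj X = Y) :
    IsSiltingSet U B ↔ IsSiltingSet T (F.obj ⁻¹' B) := by
  exact ⟨fun h => ⟨hcov.presilting_preimage h.1, hcov.generates_preimage hB h.2⟩,
    fun h => ⟨hcov.presilting_of_preimage hB h.1, .of_preimage hgen h.2⟩⟩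
end

section
/- Let G be a torsion-free abelian group and R a commutative ring graded by G. Then every G-prime ideal of R is a prime ideal of R; that is, if p is a proper homogeneous ideal of R such that for all homogeneous x, y ∈ R with xy ∈ p one has x ∈ p or y ∈ p, then for arbitrary x, y ∈ R with xy ∈ p one has x ∈ p or y ∈ p. -/
/-!
STATEMENT 15: Let `G` be a torsion-free abelian group and `R` a commutative ring
graded by `G`. Then every `G`-prime ideal of `R` is a prime ideal of `R`.
-/

/-- Two nonempty finite subsets of a torsion-free cancellative commutative monoid have a sum that is
attained exactly once. -/
theorem IsAddTorsionFree.uniqueSums (M : Type*) [AddCancelCommMonoid M] [IsAddTorsionFree M] :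
    UniqueSums M where
  uniqueAdd_of_nonempty {A B} hA hB := by
    classical
    let S := AddSubmonoid.closure ((A ∪ B : Finset M) : Set M)
    have : AddMonoid.FG S := AddMonoid.closure_finset_fg _
    have : IsAddTorsionFree S := Function.Injective.isAddTorsionFree S.subtype Subtype.val_injective
    let _ : AddCancelCommMonoid S :=
      { (inferInstance : AddCommMonoid S) with
        add_left_cancel := fun _ _ _ h ↦ Subtype.ext (add_left_cancel (congrArg Subtype.val h)) }
    have hAS : ∀ a ∈ A, a ∈ S := fun a ha ↦
      AddSubmonoid.subset_closure (by simp [ha])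
    have hBS : ∀ b ∈ B, b ∈ S := fun b hb ↦
      AddSubmonoid.subset_closure (by simp [hb])
    obtain ⟨a, ha, b, hb, h⟩ := UniqueSums.uniqueAdd_of_nonempty
      (A := A.subtype (· ∈ S)) (B := B.subtype (· ∈ S))
      (hA.elim fun a ha ↦ ⟨⟨a, hAS a ha⟩, by simpa using ha⟩)
      (hB.elim fun b hb ↦ ⟨⟨b, hBS b hb⟩, by simpa using hb⟩)
    refine ⟨a, by simpa using ha, b, by simpa using hb, fun x y hx hy hxy ↦ ?_⟩
    have := @h ⟨x, hAS x hx⟩ ⟨y, hBS y hy⟩ (by simpa using hx) (by simpa using hy)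
      (Subtype.ext hxy)
    exact ⟨congrArg Subtype.val this.1, congrArg Subtype.val this.2⟩

open DirectSum in
/-- A variant of `Ideal.IsHomogeneous.isPrime_of_homogeneous_mem_or_mem` in which the grading monoid
has unique sums instead of a compatible linear order. -/
theorem Ideal.IsHomogeneous.isPrime_of_uniqueSums {ι σ A : Type*} [CommRing A] [DecidableEq ι]
    [AddCommMonoid ι] [UniqueSums ι] [SetLike σ A] [AddSubmonoidClass σ A] {𝒜 : ι → σ}
    [GradedRing 𝒜] {I : Ideal A} (hI : I.IsHomogeneous 𝒜) (hne : I ≠ ⊤)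
    (hmem : ∀ ⦃x y : A⦄, SetLike.IsHomogeneousElem 𝒜 x → SetLike.IsHomogeneousElem 𝒜 y →
      x * y ∈ I → x ∈ I ∨ y ∈ I) :
    I.IsPrime := by
  classical
  refine ⟨hne, fun {x y} hxy ↦ ?_⟩
  by_contra! ⟨hx, hy⟩
  let T (z : A) : Finset ι := {i ∈ (decompose 𝒜 z).support | (decompose 𝒜 z i : A) ∉ I}
  have hT : ∀ z ∉ I, (T z).Nonempty := by
    intro z hz
    rw [Finset.filter_nonempty_iff]
    contrapose! hz
    rw [← sum_support_decompose 𝒜 z]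
    exact I.sum_mem hz
  obtain ⟨a, ha, b, hb, hab⟩ := UniqueSums.uniqueAdd_of_nonempty (hT x hx) (hT y hy)
  rw [Finset.mem_filter] at ha hb
  have hxy' : (decompose 𝒜 (x * y) (a + b) : A) ∈ I := hI _ hxy
  rw [decompose_mul, coe_mul_apply 𝒜,
    ← Finset.add_sum_erase _ _ (a := (a, b))
      (by simp [-DFinsupp.mem_support_toFun, ha.1, hb.1])] at hxy'
  refine (hmem ⟨a, SetLike.coe_mem _⟩ ⟨b, SetLike.coe_mem _⟩
    ((I.add_mem_iff_left (I.sum_mem ?_)).1 hxy')).elim ha.2 hb.2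
  rintro ⟨i, j⟩ hij
  simp only [Finset.mem_erase, Finset.mem_filter, Finset.mem_product] at hij
  obtain ⟨hij, ⟨hi, hj⟩, hsum⟩ := hij
  by_cases hiI : (decompose 𝒜 x i : A) ∈ I
  · exact I.mul_mem_right _ hiI
  by_cases hjI : (decompose 𝒜 y j : A) ∈ I
  · exact I.mul_mem_left _ hjI
  · obtain ⟨rfl, rfl⟩ := hab (Finset.mem_filter.2 ⟨hi, hiI⟩) (Finset.mem_filter.2 ⟨hj, hjI⟩) hsum
    exact absurd rfl hij

theorem isPrime_of_isGPrime_of_torsionFree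
    {G : Type*} [AddCommGroup G] [DecidableEq G]
    (htf : ∀ (n : ℕ) (g : G), 0 < n → n • g = 0 → g = 0)
    {R : Type*} [CommRing R] (𝒜 : G → AddSubgroup R) [GradedRing 𝒜]
    (p : Ideal R) (hp : p.IsGPrime 𝒜) :
    p.IsPrime := by
  have : IsAddTorsionFree G := ⟨fun n hn a b hab ↦
    sub_eq_zero.1 (htf n _ (Nat.pos_of_ne_zero hn) (by rw [nsmul_sub, sub_eq_zero]; exact hab))⟩
  have := IsAddTorsionFree.uniqueSums G
  exact hp.1.isPrime_of_uniqueSums hp.2.1 hp.2.2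
end
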